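/- Let d ≥ 1, s > 0, and let K̄ be a closed d-symmetric subset of ℝ^{d+1} containing the closed Euclidean unit ball B^{d+1}. Assume B^{d+1} is a locally maximal s-volume ellipsoid contained in K̄, i.e. there exists ε > 0 such that every d-symmetric ellipsoid represented by (A⊕α, a) that is contained in K̄ and satisfies ‖(A⊕α) − Ī‖_F + |a| < ε (Frobenius norm, Ī the (d+1)×(d+1) identity) has s-volume κ_s α^s det A ≤ κ_s. Then there exist an integer k with d+1 ≤ k ≤ (d+1)(d+2)/2 + d + 1, contact points ū_1, …, ū_k ∈ ∂B^{d+1} ∩ ∂K̄, and positive reals c_1, …, c_k such that Σ_{i=1}^k c_i ū_i ⊗ ū_i = S̄ and Σ_{i=1}^k c_i u_i = 0, where S̄ = diag(1, …, 1, s) is the (d+1)×(d+1) diagonal matrix with d entries 1 and last entry s, and u_i is the orthogonal projection of ū_i onto ℝ^d. -/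

import Mathlib

open MeasureTheory
open scoped BigOperators RealInnerProductSpace

noncomputable section

/-- `ℝ^d` with the Euclidean structure. -/
abbrev Ed (d : ℕ) := EuclideanSpace ℝ (Fin d)

/-- `f : ℝ^d → [0,∞)` is log-concave, i.e. `f = e^{-ψ}` for some convex
`ψ : ℝ^d → ℝ ∪ {∞}`; equivalently, `f ≥ 0` and
`f(tx+(1-t)y) ≥ f(x)^t f(y)^{1-t}`. -/
def IsLogConcave {d : ℕ} (f : Ed d → ℝ) : Prop :=
  (∀ x, 0 ≤ f x) ∧
    ∀ x y : Ed d, ∀ t : ℝ, 0 ≤ t → t ≤ 1 →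
      f x ^ t * f y ^ (1 - t) ≤ f (t • x + (1 - t) • y)

/-- A proper log-concave function: log-concave, upper semicontinuous,
with positive finite integral. -/
def ProperLogConcave {d : ℕ} (f : Ed d → ℝ) : Prop :=
  IsLogConcave f ∧ UpperSemicontinuous f ∧
    0 < ∫⁻ x, ENNReal.ofReal (f x) ∧ (∫⁻ x, ENNReal.ofReal (f x)) < ⊤

/-- The `s`-lifting of `f`, a subset of `ℝ^d × ℝ = ℝ^{d+1}`. -/
def sLift {d : ℕ} (s : ℝ) (f : Ed d → ℝ) : Set (Ed d × ℝ) :=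
  {p | |p.2| ≤ f p.1 ^ (1 / s)}

/-- The `d`-symmetric ellipsoid `(A⊕α)B^{d+1} + a` in `ℝ^{d+1} = ℝ^d × ℝ`. -/
def ellE {d : ℕ} (A : Matrix (Fin d) (Fin d) ℝ) (α : ℝ) (a : Ed d) : Set (Ed d × ℝ) :=
  {p | ∃ y : Ed d, ∃ t : ℝ, ‖y‖ ^ 2 + t ^ 2 ≤ 1 ∧
        p.1 = Matrix.toEuclideanLin A y + a ∧ p.2 = α * t}

/-- The closed Euclidean unit ball `B^{d+1}` of `ℝ^{d+1} = ℝ^d × ℝ`. -/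
def unitBallE (d : ℕ) : Set (Ed d × ℝ) := {p | ‖p.1‖ ^ 2 + p.2 ^ 2 ≤ 1}

/-- `κ_s = ∫_{B^d} (1-|x|²)^{s/2} dx`. -/
def kappa (d : ℕ) (s : ℝ) : ℝ :=
  ∫ x in Metric.closedBall (0 : Ed d) 1, (1 - ‖x‖ ^ 2) ^ (s / 2)

/-- The `s`-volume of the ellipsoid represented by `(A⊕α, a)`:
`μ_s = κ_s α^s det A`. -/
def svol {d : ℕ} (s : ℝ) (A : Matrix (Fin d) (Fin d) ℝ) (α : ℝ) : ℝ :=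
  kappa d s * α ^ s * A.det

/-- `(A, α, a)` represents the John `s`-ellipsoid of `f`: it is a d-symmetric
ellipsoid contained in the `s`-lifting of `f` of maximal `s`-volume. -/
def IsJohn {d : ℕ} (s : ℝ) (f : Ed d → ℝ)
    (A : Matrix (Fin d) (Fin d) ℝ) (α : ℝ) (a : Ed d) : Prop :=
  A.PosDef ∧ 0 < α ∧ ellE A α a ⊆ sLift s f ∧
    ∀ (A' : Matrix (Fin d) (Fin d) ℝ) (α' : ℝ) (a' : Ed d),
      A'.PosDef → 0 < α' → ellE A' α' a' ⊆ sLift s f → svol s A' α' ≤ svol s A α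

/-- The height function of the ellipsoid represented by `(A⊕α, a)`. -/
def heightFn {d : ℕ} (A : Matrix (Fin d) (Fin d) ℝ) (α : ℝ) (a : Ed d) (x : Ed d) : ℝ :=
  if ‖Matrix.toEuclideanLin A⁻¹ (x - a)‖ ≤ 1 then
    α * Real.sqrt (1 - ‖Matrix.toEuclideanLin A⁻¹ (x - a)‖ ^ 2)
  else 0

/-- A point of `ℝ^d × ℝ` as a vector in `ℝ^{d+1}`. -/
def augVec {d : ℕ} (p : Ed d × ℝ) : Fin (d + 1) → ℝ :=
  Fin.snoc (fun i => p.1 i) p.2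

/-- The block-diagonal matrix `A ⊕ α`. -/
def matAug {d : ℕ} (A : Matrix (Fin d) (Fin d) ℝ) (α : ℝ) :
    Matrix (Fin (d + 1)) (Fin (d + 1)) ℝ :=
  Matrix.of fun i j =>
    Fin.lastCases (Fin.lastCases α (fun _ => 0) j)
      (fun i' => Fin.lastCases 0 (fun j' => A i' j') j) i

/-- The Frobenius norm of a real matrix. -/
def frobNorm {n : ℕ} (M : Matrix (Fin n) (Fin n) ℝ) : ℝ :=
  Real.sqrt (∑ i, ∑ j, M i j ^ 2)

/-- Asplund sum (sup-convolution) of two functions. -/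
def asplund {d : ℕ} (f g : Ed d → ℝ) : Ed d → ℝ :=
  fun x => ⨆ y : Ed d, f y * g (x - y)

/-- Epi-product `(λ ∗ f)(x) = f(x/λ)^λ`. -/
def epiProd {d : ℕ} (l : ℝ) (f : Ed d → ℝ) : Ed d → ℝ :=
  fun x => f (l⁻¹ • x) ^ l

/-- The flat ellipsoid function `α · χ_{A B^d + a}`. -/
def flatFn {d : ℕ} (A : Matrix (Fin d) (Fin d) ℝ) (α : ℝ) (a : Ed d) (x : Ed d) : ℝ :=
  if ‖Matrix.toEuclideanLin A⁻¹ (x - a)‖ ≤ 1 then α else 0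

/-- The Gaussian density `G[(A⊕α, a)](x) = α e^{−|A^{-1}(x−a)|²}`. -/
def gaussFn {d : ℕ} (A : Matrix (Fin d) (Fin d) ℝ) (α : ℝ) (a : Ed d) (x : Ed d) : ℝ :=
  α * Real.exp (-‖Matrix.toEuclideanLin A⁻¹ (x - a)‖ ^ 2)

/-- Operator (`ℓ₂ → ℓ₂`) norm of a matrix. -/
def opNorm {d : ℕ} (M : Matrix (Fin d) (Fin d) ℝ) : ℝ :=
  ‖Matrix.toEuclideanCLM (𝕜 := ℝ) M‖

section BlockPerturbation

open Filter Topology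

variable {d : ℕ}

/-- The quadratic function on `ℝ^d × ℝ` with block-diagonal quadratic part `H ⊕ β` and linear
part `h`. -/
def blockQuad (H : Matrix (Fin d) (Fin d) ℝ) (β : ℝ) (h : Ed d) (p : Ed d × ℝ) : ℝ :=
  ⟪Matrix.toEuclideanLin H p.1, p.1⟫ + β * p.2 ^ 2 + ⟪h, p.1⟫

theorem isCompact_unitBallE (d : ℕ) : IsCompact (unitBallE d) := by
  refine (isCompact_closedBall (0 : Ed d × ℝ) 1).of_isClosed_subset ?_ fun p hp => ?_
  · exact isClosed_le (by fun_prop) continuous_const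
  · have hp' : ‖p.1‖ ^ 2 + p.2 ^ 2 ≤ 1 := hp
    rw [mem_closedBall_zero_iff, Prod.norm_def, sup_le_iff, Real.norm_eq_abs]
    exact ⟨by nlinarith [sq_nonneg p.2, norm_nonneg p.1],
      (sq_le_one_iff_abs_le_one _).1 (by nlinarith [sq_nonneg ‖p.1‖])⟩

theorem continuous_toEuclideanLin (H : Matrix (Fin d) (Fin d) ℝ) :
    Continuous (Matrix.toEuclideanLin H) :=
  LinearMap.continuous_of_finiteDimensional _

theorem toEuclideanLin_one_add_smul (H : Matrix (Fin d) (Fin d) ℝ) (δ : ℝ) (y : Ed d) :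
    Matrix.toEuclideanLin (1 + δ • H) y = y + δ • Matrix.toEuclideanLin H y := by
  rw [map_add, map_smul, LinearMap.add_apply, LinearMap.smul_apply]
  congr 1
  ext i
  simp

/-- A small perturbation of the unit ball that moves every contact point strictly inwards to first
order stays inside `K`. -/
theorem eventually_ellE_subset {K : Set (Ed d × ℝ)} (hB : unitBallE d ⊆ K)
    (H : Matrix (Fin d) (Fin d) ℝ) (β : ℝ) (h : Ed d)
    (hneg : ∀ p ∈ frontier (unitBallE d) ∩ frontier K, blockQuad H β h p < 0) :
    ∀ᶠ δ in 𝓝[>] (0 : ℝ), ellE (1 + δ • H) (1 + δ * β) (δ • h) ⊆ K := by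
  have hH := continuous_toEuclideanLin H
  let Y : ℝ → Ed d × ℝ → Ed d × ℝ := fun δ p =>
    (p.1 + δ • Matrix.toEuclideanLin H p.1 + δ • h, (1 + δ * β) * p.2)
  have hY : Continuous fun z : ℝ × (Ed d × ℝ) => Y z.1 z.2 := by
    have := hH.comp (continuous_fst.comp (continuous_snd (X := ℝ) (Y := Ed d × ℝ)))
    simp only [Y]
    fun_prop
  have key : ∀ᶠ δ in 𝓝 (0 : ℝ), ∀ p ∈ unitBallE d, p ∈ unitBallE d →
      0 < δ → Y δ p ∈ K := by
    refine IsCompact.eventually_forall_of_forall_eventually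
      (P := fun δ p => p ∈ unitBallE d → 0 < δ → Y δ p ∈ K) (isCompact_unitBallE d) fun p hp => ?_
    have hY0 : Y 0 p = p := by simp [Y]
    have hcont : ∀ᶠ z : ℝ × (Ed d × ℝ) in 𝓝 (0, p), p ∈ interior K → Y z.1 z.2 ∈ K := by
      by_cases hpK : p ∈ interior K
      · have := hY.continuousAt (x := (0, p)) (by
          rw [hY0]; exact mem_interior_iff_mem_nhds.1 hpK : K ∈ 𝓝 (Y 0 p))
        filter_upwards [this] with z hz _ using hz
      · exact Eventually.of_forall fun _ h => absurd h hpK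
    by_cases hfB : p ∈ frontier (unitBallE d)
    · by_cases hfK : p ∈ frontier K
      · have hg : Continuous fun z : ℝ × (Ed d × ℝ) => 2 * blockQuad H β h z.2 +
            z.1 * (‖Matrix.toEuclideanLin H z.2.1 + h‖ ^ 2 + (β * z.2.2) ^ 2) := by
          unfold blockQuad
          fun_prop
        have hlt : ∀ᶠ z : ℝ × (Ed d × ℝ) in 𝓝 (0, p), 2 * blockQuad H β h z.2 +
            z.1 * (‖Matrix.toEuclideanLin H z.2.1 + h‖ ^ 2 + (β * z.2.2) ^ 2) < 0 :=
          hg.continuousAt.eventually_lt continuousAt_const (by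
            have := hneg p ⟨hfB, hfK⟩
            simp only [zero_mul, add_zero]
            linarith)
        filter_upwards [hlt] with ⟨δ, y, t⟩ hz hyt hδ
        refine hB ?_
        have hyt' : ‖y‖ ^ 2 + t ^ 2 ≤ 1 := hyt
        change ‖y + δ • Matrix.toEuclideanLin H y + δ • h‖ ^ 2 + ((1 + δ * β) * t) ^ 2 ≤ 1
        rw [add_assoc, ← smul_add, norm_add_sq_real, inner_smul_right, norm_smul, mul_pow,
          Real.norm_eq_abs, sq_abs, real_inner_comm, inner_add_left]
        have := mul_neg_of_pos_of_neg hδ hz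
        simp only [blockQuad] at this
        linarith
      · have hpK : p ∈ interior K := by
          by_contra hn
          exact hfK ⟨subset_closure (hB hp), hn⟩
        filter_upwards [hcont] with z hz _ _ using hz hpK
    · have hpK : p ∈ interior K := by
        by_contra hn
        exact hfB ⟨subset_closure hp, fun h => hn (interior_mono hB h)⟩
      filter_upwards [hcont] with z hz _ _ using hz hpK
  filter_upwards [nhdsWithin_le_nhds key, self_mem_nhdsWithin] with δ hδ hδ0
  rintro ⟨u, v⟩ ⟨y, t, hyt, hu, hv⟩
  simp only at hu hv
  have := hδ (y, t) hyt hyt hδ0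
  rwa [hu, hv, toEuclideanLin_one_add_smul]

theorem kappa_pos (d : ℕ) {s : ℝ} (hs : 0 < s) : 0 < kappa d s := by
  have hcont : Continuous fun x : Ed d => (1 - ‖x‖ ^ 2) ^ (s / 2) :=
    (by fun_prop : Continuous fun x : Ed d => 1 - ‖x‖ ^ 2).rpow_const fun _ => Or.inr (by positivity)
  unfold kappa
  rw [setIntegral_pos_iff_support_of_nonneg_ae]
  · refine (Metric.measure_ball_pos volume (0 : Ed d) one_pos).trans_le (measure_mono fun x hx => ?_)
    refine ⟨?_, Metric.ball_subset_closedBall hx⟩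
    rw [mem_ball_zero_iff] at hx
    exact (Real.rpow_pos_of_pos (by nlinarith [norm_nonneg x]) _).ne'
  · filter_upwards [ae_restrict_mem Metric.isClosed_closedBall.measurableSet] with x hx
    rw [mem_closedBall_zero_iff] at hx
    exact Real.rpow_nonneg (by nlinarith [norm_nonneg x]) _
  · exact hcont.continuousOn.integrableOn_compact (isCompact_closedBall _ _)

theorem eventually_posDef_one_add_smul {H : Matrix (Fin d) (Fin d) ℝ} (hH : H.IsSymm) :
    ∀ᶠ δ in 𝓝 (0 : ℝ), (1 + δ • H).PosDef := by
  set T := Matrix.toEuclideanCLM (𝕜 := ℝ) H with hT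
  have hsmall : ∀ᶠ δ in 𝓝 (0 : ℝ), |δ| * ‖T‖ < 1 :=
    (by fun_prop : Continuous fun δ : ℝ => |δ| * ‖T‖).continuousAt.eventually_lt
      continuousAt_const (by simp)
  filter_upwards [hsmall] with δ hδ
  refine Matrix.PosDef.of_dotProduct_mulVec_pos ?_ fun x hx => ?_
  · rw [Matrix.IsHermitian, Matrix.conjTranspose_eq_transpose_of_trivial, Matrix.transpose_add,
      Matrix.transpose_smul, hH.eq, Matrix.transpose_one]
  · set y : Ed d := WithLp.toLp 2 x with hy
    have hy0 : 0 < ‖y‖ := norm_pos_iff.2 (by simpa [hy] using hx)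
    have h1 : star x ⬝ᵥ ((1 + δ • H).mulVec x) = ‖y‖ ^ 2 + δ * ⟪y, T y⟫ := by
      rw [hT, Matrix.inner_toEuclideanCLM, Matrix.add_mulVec, Matrix.one_mulVec, dotProduct_add,
        Matrix.smul_mulVec, dotProduct_smul, EuclideanSpace.real_norm_sq_eq]
      simp [dotProduct, hy, sq]
    rw [h1]
    have h2 : |δ * ⟪y, T y⟫| ≤ |δ| * ‖T‖ * ‖y‖ ^ 2 := by
      rw [abs_mul, mul_assoc]
      refine mul_le_mul_of_nonneg_left ?_ (abs_nonneg _)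
      calc |⟪y, T y⟫| ≤ ‖y‖ * ‖T y‖ := abs_real_inner_le_norm _ _
        _ ≤ ‖y‖ * (‖T‖ * ‖y‖) := by gcongr; exact T.le_opNorm y
        _ = ‖T‖ * ‖y‖ ^ 2 := by ring
    have h3 := neg_abs_le (δ * ⟪y, T y⟫)
    nlinarith [pow_pos hy0 2]

theorem continuous_frobNorm_matAug (H : Matrix (Fin d) (Fin d) ℝ) (β : ℝ) :
    Continuous fun δ : ℝ => frobNorm (matAug (1 + δ • H) (1 + δ * β) - 1) := by
  refine Real.continuous_sqrt.comp (continuous_finsetSum _ fun i _ => continuous_finsetSum _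
    fun j _ => ?_)
  refine Continuous.pow (Continuous.sub ?_ continuous_const) 2
  induction i using Fin.lastCases <;> induction j using Fin.lastCases <;>
    simp only [matAug, Matrix.of_apply, Fin.lastCases_last, Fin.lastCases_castSucc,
      Matrix.add_apply, Matrix.smul_apply, smul_eq_mul] <;> fun_prop

theorem matAug_one_one (d : ℕ) : matAug (1 : Matrix (Fin d) (Fin d) ℝ) 1 = 1 := by
  ext i j
  induction i using Fin.lastCases <;> induction j using Fin.lastCases <;>
    simp [matAug, Matrix.one_apply, Fin.castSucc_ne_last, (Fin.castSucc_ne_last _).symm]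

theorem frobNorm_zero {n : ℕ} : frobNorm (0 : Matrix (Fin n) (Fin n) ℝ) = 0 := by
  simp [frobNorm]

theorem hasDerivAt_det_one_add_smul (H : Matrix (Fin d) (Fin d) ℝ) :
    HasDerivAt (fun δ : ℝ => (1 + δ • H).det) H.trace 0 := by
  rw [funext fun δ : ℝ => Matrix.det_one_add_smul δ H]
  have h1 := ((hasDerivAt_id (0 : ℝ)).const_mul H.trace).const_add 1
  have h2 := ((Matrix.det (1 + (Polynomial.X : Polynomial ℝ) • H.map Polynomial.C)).divX.divX
    |>.hasDerivAt (0 : ℝ)).mul ((hasDerivAt_id (0 : ℝ)).pow 2)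
  have h3 := h1.add h2
  simp only [mul_one, id_eq, ne_eq, OfNat.ofNat_ne_zero, not_false_eq_true, zero_pow, mul_zero,
    Nat.cast_ofNat, Nat.add_one_sub_one, pow_one, add_zero, Pi.pow_apply] at h3
  exact h3

/-- The `s`-volume strictly increases to first order in a direction `H ⊕ β` with
`tr H + s β > 0`. -/
theorem eventually_lt_svol {s : ℝ} (hs : 0 < s) {H : Matrix (Fin d) (Fin d) ℝ} {β : ℝ}
    (hpos : 0 < H.trace + s * β) :
    ∀ᶠ δ in 𝓝[>] (0 : ℝ), kappa d s < svol s (1 + δ • H) (1 + δ * β) := by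
  have h1 : HasDerivAt (fun δ : ℝ => (1 + δ * β) ^ s) (s * β) 0 := by
    have := (((hasDerivAt_id (0 : ℝ)).mul_const β).const_add 1).rpow_const (p := s)
      (Or.inl (by simp))
    simpa [mul_comm] using this
  have h2 : HasDerivAt (fun δ : ℝ => (1 + δ * β) ^ s * (1 + δ • H).det) (H.trace + s * β) 0 := by
    have := h1.mul (hasDerivAt_det_one_add_smul H)
    simp only [zero_mul, add_zero, Real.one_rpow, zero_smul, Matrix.det_one, mul_one,
      one_mul] at this
    rwa [add_comm] at this
  have h3 := (hasDerivAt_iff_tendsto_slope.1 h2).eventually (lt_mem_nhds hpos)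
  filter_upwards [nhdsWithin_mono _ (fun x (hx : 0 < x) => hx.ne') h3, self_mem_nhdsWithin]
    with δ hδ hδ0
  have hδ0 : 0 < δ := hδ0
  rw [slope_def_field] at hδ
  have h4 : 1 < (1 + δ * β) ^ s * (1 + δ • H).det := by
    have := (div_pos_iff_of_pos_right (by simpa using hδ0)).1 hδ
    simpa using this
  rw [svol, mul_assoc]
  exact lt_mul_of_one_lt_right (kappa_pos d hs) h4

/-- If the unit ball locally maximizes the `s`-volume in `K`, no direction increasing the
`s`-volume to first order moves all contact points strictly inwards. -/
theorem exists_contact_blockQuad_nonneg {s : ℝ} (hs : 0 < s) {K : Set (Ed d × ℝ)}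
    (hB : unitBallE d ⊆ K)
    (hloc : ∃ ε > (0 : ℝ), ∀ (A : Matrix (Fin d) (Fin d) ℝ) (α : ℝ) (a : Ed d),
      A.PosDef → 0 < α → ellE A α a ⊆ K →
        frobNorm (matAug A α - 1) + ‖a‖ < ε → svol s A α ≤ kappa d s)
    {H : Matrix (Fin d) (Fin d) ℝ} (hH : H.IsSymm) {β : ℝ} (h : Ed d)
    (hpos : 0 < H.trace + s * β) :
    ∃ p ∈ frontier (unitBallE d) ∩ frontier K, 0 ≤ blockQuad H β h p := by
  by_contra! hneg
  obtain ⟨ε, hε, hmax⟩ := hloc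
  have hα : ∀ᶠ δ in 𝓝 (0 : ℝ), 0 < 1 + δ * β :=
    continuousAt_const.eventually_lt
      (by fun_prop : Continuous fun δ : ℝ => 1 + δ * β).continuousAt (by simp)
  have hnear : ∀ᶠ δ in 𝓝 (0 : ℝ),
      frobNorm (matAug (1 + δ • H) (1 + δ * β) - 1) + ‖δ • h‖ < ε := by
    have := continuous_frobNorm_matAug H β
    refine (by fun_prop : Continuous fun δ : ℝ =>
      frobNorm (matAug (1 + δ • H) (1 + δ * β) - 1) + ‖δ • h‖).continuousAt.eventually_lt
        continuousAt_const ?_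
    simpa [matAug_one_one, frobNorm_zero] using hε
  obtain ⟨δ, h1, h2, h3, h4, h5⟩ := ((eventually_ellE_subset hB H β h hneg).and
    ((eventually_lt_svol hs hpos).and ((hα.and (hnear.and
      (eventually_posDef_one_add_smul hH))).filter_mono nhdsWithin_le_nhds))).exists
  exact (hmax _ _ _ h5 h3 h1 h4).not_gt h2

theorem isCompact_convexHull_of_finiteDimensional {E : Type*} [NormedAddCommGroup E]
    [NormedSpace ℝ E] [FiniteDimensional ℝ E] {S : Set E} (hS : IsCompact S) :
    IsCompact (convexHull ℝ S) := by
  let F : (n : ℕ) → (Fin n → ℝ) × (Fin n → E) → E := fun n q => ∑ i, q.1 i • q.2 i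
  have hEq : convexHull ℝ S = ⋃ n ∈ Finset.range (Module.finrank ℝ E + 2),
      F n '' (stdSimplex ℝ (Fin n) ×ˢ Set.univ.pi fun _ => S) := by
    refine subset_antisymm (fun x hx => ?_) (Set.iUnion₂_subset fun n _ => ?_)
    · obtain ⟨ι, _, z, w, hzS, hz, hw, hw1, rfl⟩ := eq_pos_convex_span_of_mem_convexHull hx
      have hcard : Fintype.card ι < Module.finrank ℝ E + 2 :=
        (hz.card_le_finrank_succ.trans (Nat.succ_le_succ (Submodule.finrank_le _))).trans_lt
          (Nat.lt_succ_self _)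
      let e := (Fintype.equivFin ι).symm
      refine Set.mem_iUnion₂.2 ⟨_, Finset.mem_range.2 hcard, (w ∘ e, z ∘ e),
        ⟨⟨fun i => (hw _).le, ?_⟩, fun i _ => hzS ⟨_, rfl⟩⟩, ?_⟩
      · simpa using (e.sum_comp w).trans hw1
      · exact e.sum_comp fun i => w i • z i
    · rintro _ ⟨⟨w, z⟩, ⟨hw, hz⟩, rfl⟩
      exact (convex_convexHull ℝ S).sum_mem (fun i _ => hw.1 i) hw.2
        fun i _ => subset_convexHull ℝ S (hz i trivial)
  rw [hEq]
  refine Finset.isCompact_biUnion _ fun n _ =>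
    ((isCompact_stdSimplex ℝ (Fin n)).prod (isCompact_univ_pi fun _ => hS)).image ?_
  simp only [F]
  fun_prop

/-- The symmetric part of a square matrix, as a function on unordered pairs of indices. -/
def symPart (n : ℕ) : Matrix (Fin n) (Fin n) ℝ →ₗ[ℝ] (Sym2 (Fin n) → ℝ) where
  toFun M := Sym2.lift ⟨fun i j => (M i j + M j i) / 2, fun i j => by dsimp only; rw [add_comm]⟩
  map_add' M N := by
    ext z
    induction z with | _ i j => simp; ring
  map_smul' c M := by
    ext z
    induction z with | _ i j => simp; ring

theorem symPart_mk {n : ℕ} (M : Matrix (Fin n) (Fin n) ℝ) (i j : Fin n) :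
    symPart n M s(i, j) = (M i j + M j i) / 2 := rfl

theorem symPart_transpose {n : ℕ} (M : Matrix (Fin n) (Fin n) ℝ) :
    symPart n M.transpose = symPart n M := by
  ext z
  induction z with | _ i j => simp [symPart_mk, add_comm]

theorem symPart_injOn {n : ℕ} {M N : Matrix (Fin n) (Fin n) ℝ} (hM : M.IsSymm) (hN : N.IsSymm)
    (h : symPart n M = symPart n N) : M = N := by
  ext i j
  have h1 := congrFun h s(i, j)
  rw [symPart_mk, symPart_mk, hM.apply i j, hN.apply i j] at h1
  linarith

theorem le_of_sum_vecMulVec_eq_diagonal {n k : ℕ} {c : Fin k → ℝ} {x : Fin k → Fin n → ℝ}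
    {D : Fin n → ℝ} (hD : ∀ i, D i ≠ 0)
    (h : ∑ i, c i • Matrix.vecMulVec (x i) (x i) = Matrix.diagonal D) : n ≤ k := by
  have hprod : ∑ i, c i • Matrix.vecMulVec (x i) (x i) =
      (Matrix.of fun a i => c i * x i a) * Matrix.of x := by
    ext a b
    simp [Matrix.sum_apply, Matrix.mul_apply, Matrix.vecMulVec_apply, mul_assoc]
  have hrank : (Matrix.diagonal D).rank = n := by
    rw [Matrix.rank_of_det_ne_zero, Fintype.card_fin]
    rw [Matrix.det_diagonal]
    exact Finset.prod_ne_zero_iff.2 fun i _ => hD i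
  rw [← hrank, ← h, hprod]
  exact (Matrix.rank_mul_le_left _ _).trans (Matrix.rank_le_width _)

theorem isSymm_vecMulVec_self {n : ℕ} (x : Fin n → ℝ) : (Matrix.vecMulVec x x).IsSymm := by
  ext i j
  simp [Matrix.vecMulVec_apply, mul_comm]

/-- The point `p` as the pair of `p ⊗ p` and the projection of `p` onto `ℝ^d`. -/
def tensorProj {d : ℕ} (p : Ed d × ℝ) : (Sym2 (Fin (d + 1)) → ℝ) × Ed d :=
  (symPart (d + 1) (Matrix.vecMulVec (augVec p) (augVec p)), p.1)

theorem continuous_tensorProj : Continuous (tensorProj (d := d)) := by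
  have haug : ∀ i, Continuous fun p : Ed d × ℝ => augVec p i := by
    intro i
    induction i using Fin.lastCases <;> simp only [augVec, Fin.snoc_last, Fin.snoc_castSucc] <;>
      fun_prop
  refine Continuous.prodMk ((LinearMap.continuous_of_finiteDimensional _).comp ?_) continuous_fst
  exact continuous_matrix fun i j => (haug i).mul (haug j)

/-- A linear functional on the target of `tensorProj`, averaged over the reflection in `ℝ^d`, is
given by a block-diagonal quadratic function. -/
theorem exists_blockQuad_eq (f : ((Sym2 (Fin (d + 1)) → ℝ) × Ed d) →ₗ[ℝ] ℝ) :
    ∃ (H : Matrix (Fin d) (Fin d) ℝ) (β : ℝ) (h : Ed d), H.IsSymm ∧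
      (∀ p : Ed d × ℝ, blockQuad H β h p =
        (f (tensorProj p) + f (tensorProj (p.1, -p.2))) / 2) ∧
      ∀ s : ℝ, f (symPart (d + 1) (Matrix.diagonal (Fin.snoc (fun _ : Fin d => (1 : ℝ)) s)), 0) =
        H.trace + s * β := by
  let G : Matrix (Fin (d + 1)) (Fin (d + 1)) ℝ :=
    Matrix.of fun i j => f (symPart (d + 1) (Matrix.single i j 1), 0)
  have hG : ∀ M, f (symPart (d + 1) M, 0) = ∑ i, ∑ j, M i j * G i j := by
    intro M
    let g : Matrix (Fin (d + 1)) (Fin (d + 1)) ℝ →ₗ[ℝ] ℝ :=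
      f ∘ₗ LinearMap.inl ℝ _ _ ∘ₗ symPart (d + 1)
    change g M = ∑ i, ∑ j, M i j * g (Matrix.single i j 1)
    conv_lhs => rw [Matrix.matrix_eq_sum_single M]
    simp only [map_sum]
    refine Finset.sum_congr rfl fun i _ => Finset.sum_congr rfl fun j _ => ?_
    rw [← smul_eq_mul, ← map_smul, Matrix.smul_single, smul_eq_mul, mul_one]
  have hGs : ∀ i j, G i j = G j i := by
    intro i j
    simp only [G, Matrix.of_apply]
    rw [← symPart_transpose, Matrix.transpose_single]
  let ℓ : StrongDual ℝ (Ed d) := LinearMap.toContinuousLinearMap (f ∘ₗ LinearMap.inr ℝ _ _)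
  let h : Ed d := (InnerProductSpace.toDual ℝ (Ed d)).symm ℓ
  have hh : ∀ v, ⟪h, v⟫ = f (0, v) := fun v => InnerProductSpace.toDual_symm_apply
  refine ⟨Matrix.of fun i j => G i.castSucc j.castSucc, G (Fin.last d) (Fin.last d), h, ?_, ?_, ?_⟩
  · ext i j
    exact hGs _ _
  · intro p
    have hsplit : ∀ q, f (tensorProj q) =
        f (symPart (d + 1) (Matrix.vecMulVec (augVec q) (augVec q)), 0) + f (0, q.1) := by
      intro q
      rw [← map_add, Prod.mk_add_mk, add_zero, zero_add]
      rfl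
    rw [hsplit, hsplit, hG, hG, blockQuad, hh]
    simp only [Fin.sum_univ_castSucc, Matrix.vecMulVec_apply, augVec, Fin.snoc_castSucc,
      Fin.snoc_last, EuclideanSpace.inner_eq_star_dotProduct]
    simp only [dotProduct, Matrix.ofLp_toLpLin, Matrix.toLin'_apply, Matrix.mulVec,
      Matrix.of_apply, star_trivial, Finset.mul_sum, Finset.sum_add_distrib, mul_neg, neg_mul,
      Finset.sum_neg_distrib, Pi.star_apply, neg_neg]
    have : ∀ i j : Fin d, p.1 i * (G i.castSucc j.castSucc * p.1 j) =
      p.1 i * p.1 j * G i.castSucc j.castSucc := fun i j => by ring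
    simp only [this]
    ring
  · intro s
    rw [hG]
    simp [Matrix.diagonal_apply, Fin.sum_univ_castSucc, Matrix.trace,
      ite_mul]

/-- The reflection of `ℝ^d × ℝ` in `ℝ^d`. -/
def reflE (d : ℕ) : Ed d × ℝ ≃ₜ Ed d × ℝ :=
  (Homeomorph.refl _).prodCongr (Homeomorph.neg ℝ)

theorem refl_mem_frontier {S : Set (Ed d × ℝ)}
    (hS : ∀ p ∈ S, ((p.1, -p.2) : Ed d × ℝ) ∈ S) {p : Ed d × ℝ} (hp : p ∈ frontier S) :
    ((p.1, -p.2) : Ed d × ℝ) ∈ frontier S := by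
  have hpre : reflE d ⁻¹' S = S := by
    ext q
    refine ⟨fun hq => ?_, fun hq => hS q hq⟩
    have := hS _ hq
    simpa [reflE] using this
  change p ∈ reflE d ⁻¹' frontier S
  rwa [Homeomorph.preimage_frontier, hpre]

theorem norm_sq_of_mem_frontier_unitBallE {p : Ed d × ℝ} (hp : p ∈ frontier (unitBallE d)) :
    ‖p.1‖ ^ 2 + p.2 ^ 2 = 1 :=
  frontier_le_subset_eq (f := fun p : Ed d × ℝ => ‖p.1‖ ^ 2 + p.2 ^ 2) (by fun_prop)
    continuous_const hp

theorem blockQuad_sub_smul_one (H : Matrix (Fin d) (Fin d) ℝ) (β r : ℝ) (h : Ed d)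
    (p : Ed d × ℝ) :
    blockQuad (H - r • 1) (β - r) h p = blockQuad H β h p - r * (‖p.1‖ ^ 2 + p.2 ^ 2) := by
  have h1 : Matrix.toEuclideanLin (1 : Matrix (Fin d) (Fin d) ℝ) p.1 = p.1 := by ext i; simp
  rw [blockQuad, blockQuad, map_sub, map_smul, LinearMap.sub_apply, LinearMap.smul_apply, h1,
    inner_sub_left, real_inner_smul_left, real_inner_self_eq_norm_sq]
  ring

/-- At a locally maximal unit ball, the normalized matrix `diag(1, …, 1, s)` is a barycentre of
contact points. -/
theorem mem_convexHull_tensorProj {s : ℝ} (hs : 0 < s) {K : Set (Ed d × ℝ)}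
    (hKsym : ∀ p ∈ K, ((p.1, -p.2) : Ed d × ℝ) ∈ K) (hB : unitBallE d ⊆ K)
    (hloc : ∃ ε > (0 : ℝ), ∀ (A : Matrix (Fin d) (Fin d) ℝ) (α : ℝ) (a : Ed d),
      A.PosDef → 0 < α → ellE A α a ⊆ K →
        frobNorm (matAug A α - 1) + ‖a‖ < ε → svol s A α ≤ kappa d s) :
    ((d + s)⁻¹ • (symPart (d + 1) (Matrix.diagonal (Fin.snoc (fun _ : Fin d => (1 : ℝ)) s)), 0) :
      (Sym2 (Fin (d + 1)) → ℝ) × Ed d) ∈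
      convexHull ℝ (tensorProj '' (frontier (unitBallE d) ∩ frontier K)) := by
  by_contra hb
  have hds : 0 < d + s := by positivity
  have hC : IsCompact (frontier (unitBallE d) ∩ frontier K) :=
    (isCompact_unitBallE d).of_isClosed_subset (isClosed_frontier.inter isClosed_frontier)
      fun p hp => (isCompact_unitBallE d).isClosed.frontier_subset hp.1
  obtain ⟨f, r, hfr, hrf⟩ := geometric_hahn_banach_closed_point (convex_convexHull ℝ _)
    (isCompact_convexHull_of_finiteDimensional (hC.image continuous_tensorProj)).isClosed hb
  obtain ⟨H, β, h, hH, hquad, hdiag⟩ := exists_blockQuad_eq f.toLinearMap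
  have hpos : 0 < (H - r • (1 : Matrix (Fin d) (Fin d) ℝ)).trace + s * (β - r) := by
    have h1 := hdiag s
    rw [ContinuousLinearMap.coe_coe] at h1
    rw [map_smul, h1, smul_eq_mul, inv_mul_eq_div, lt_div_iff₀ hds] at hrf
    rw [Matrix.trace_sub, Matrix.trace_smul, Matrix.trace_one, Fintype.card_fin, smul_eq_mul]
    linarith
  obtain ⟨p, hp, hp0⟩ := exists_contact_blockQuad_nonneg hs hB hloc
    (hH.sub (Matrix.isSymm_one.smul r)) h hpos
  rw [blockQuad_sub_smul_one, norm_sq_of_mem_frontier_unitBallE hp.1, hquad] at hp0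
  have hp' : ((p.1, -p.2) : Ed d × ℝ) ∈ frontier (unitBallE d) ∩ frontier K :=
    ⟨refl_mem_frontier (fun q hq => by simpa [unitBallE] using hq) hp.1,
      refl_mem_frontier hKsym hp.2⟩
  have h1 := hfr _ (subset_convexHull ℝ _ (Set.mem_image_of_mem tensorProj hp))
  have h2 := hfr _ (subset_convexHull ℝ _ (Set.mem_image_of_mem tensorProj hp'))
  simp only [ContinuousLinearMap.coe_coe] at hp0
  linarith

end BlockPerturbation

/-- **John's condition, necessity** (Theorem 5.1 part (1)). -/
theorem john_condition_local_max (d : ℕ) (hd : 1 ≤ d) (s : ℝ) (hs : 0 < s)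
    (K : Set (Ed d × ℝ)) (hKcl : IsClosed K)
    (hKsym : ∀ p ∈ K, ((p.1, -p.2) : Ed d × ℝ) ∈ K)
    (hB : unitBallE d ⊆ K)
    (hloc : ∃ ε > (0 : ℝ), ∀ (A : Matrix (Fin d) (Fin d) ℝ) (α : ℝ) (a : Ed d),
      A.PosDef → 0 < α → ellE A α a ⊆ K →
        frobNorm (matAug A α - 1) + ‖a‖ < ε → svol s A α ≤ kappa d s) :
    ∃ (k : ℕ) (u : Fin k → Ed d × ℝ) (c : Fin k → ℝ),
      d + 1 ≤ k ∧ k ≤ (d + 1) * (d + 2) / 2 + d + 1 ∧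
      (∀ i, u i ∈ frontier (unitBallE d) ∩ frontier K) ∧
      (∀ i, 0 < c i) ∧
      (∑ i, c i • Matrix.vecMulVec (augVec (u i)) (augVec (u i))) =
        Matrix.diagonal (Fin.snoc (fun _ : Fin d => (1 : ℝ)) s) ∧
      (∑ i, c i • (u i).1) = 0 := by
  obtain ⟨ι, _, z, w, hzC, hz, hw, hw1, hsum⟩ :=
    eq_pos_convex_span_of_mem_convexHull (mem_convexHull_tensorProj hs hKsym hB hloc)
  have hds : 0 < d + s := by positivity
  let e := (Fintype.equivFin ι).symm
  choose u huC hu using fun i => hzC (Set.mem_range_self (e i))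
  have hsum' : ∑ i, ((d + s) * w (e i)) • tensorProj (u i) =
      (symPart (d + 1) (Matrix.diagonal (Fin.snoc (fun _ : Fin d => (1 : ℝ)) s)), 0) := by
    simp only [hu, mul_smul, ← Finset.smul_sum]
    rw [e.sum_comp fun i => w i • z i, hsum, smul_inv_smul₀ hds.ne']
  have hmat : ∑ i, ((d + s) * w (e i)) • Matrix.vecMulVec (augVec (u i)) (augVec (u i)) =
      Matrix.diagonal (Fin.snoc (fun _ : Fin d => (1 : ℝ)) s) := by
    refine symPart_injOn ?_ (Matrix.isSymm_diagonal _) ?_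
    · rw [Matrix.IsSymm, Matrix.transpose_sum]
      exact Finset.sum_congr rfl fun i _ => ((isSymm_vecMulVec_self _).smul _).eq
    · simpa [tensorProj, Prod.fst_sum] using congrArg Prod.fst hsum'
  refine ⟨Fintype.card ι, u, fun i => (d + s) * w (e i), ?_, ?_, huC,
    fun i => mul_pos hds (hw _), hmat, ?_⟩
  · refine le_of_sum_vecMulVec_eq_diagonal (fun i => ?_) hmat
    induction i using Fin.lastCases <;> simp [hs.ne']
  · refine hz.card_le_finrank_succ.trans (Nat.succ_le_succ ((Submodule.finrank_le _).trans ?_))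
    rw [Module.finrank_prod, Module.finrank_fintype_fun_eq_card, Sym2.card, Fintype.card_fin,
      finrank_euclideanSpace_fin, Nat.choose_two_right, Nat.add_sub_cancel, mul_comm]
  · simpa [tensorProj, Prod.snd_sum] using congrArg Prod.snd hsum'
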